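/- arXiv:2407.04310 — 4 statements merged into one kernel-verified Lean document; each statement's English description precedes it below -/
import Mathlib

section
/- Let x, y be real symmetric 2×2 matrices with y positive definite, let p = (p₁, p₂), q = (q₁, q₂) be real 1×2 row vectors, and let γ, δ > 0. Set D = y₁₁y₂₂ − y₁₂², I₂ = p₂q₁ − p₁q₂, A = 2[(x₁₁ − x₂₂)y₁₂ − x₁₂(y₁₁ − y₂₂)], B = 4x₁₂² + (x₁₁ − x₂₂)² + y₁₁² + y₂₂² + 2y₁₂². Let F be the symmetric 5×5 matrix given in blocks (row/column order q₁, q₂, p₁, p₂, κ) by F = [[γ·y⁻¹ + δ·pᵗp, γ·y⁻¹x − δ·qᵗp, −δ·pᵗ], [γ·x y⁻¹ − δ·pᵗq, γ·(y + x y⁻¹ x) + δ·qᵗq, δ·qᵗ], [−δ·p, δ·q, δ]]. Then det F = δ·[γ⁴ − γ³·(δI₂/D)·A − γ²·((δI₂)²/D)·B − γ·((δI₂)³/D)·A + (δI₂)⁴]. -/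
open Matrix

/-- The determinant of the `(q,p,κ)`-block `g'(q,p,κ)` of the metric matrix of
the `G^J_2(ℝ)`-invariant metric on the extended Siegel–Jacobi upper half space
`𝒳̃₂ᴶ`. -/
theorem det_gprime_extended_space_n2
    (x y : Matrix (Fin 2) (Fin 2) ℝ)
    (hx : x.IsSymm) (hy : y.IsSymm) (hypd : y.PosDef)
    (p q : Matrix (Fin 1) (Fin 2) ℝ) (γ δ : ℝ) (hγ : 0 < γ) (hδ : 0 < δ)
    (D I₂ A B : ℝ)
    (hD : D = y 0 0 * y 1 1 - y 0 1 ^ 2)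
    (hI : I₂ = p 0 1 * q 0 0 - p 0 0 * q 0 1)
    (hA : A = 2 * ((x 0 0 - x 1 1) * y 0 1 - x 0 1 * (y 0 0 - y 1 1)))
    (hB : B = 4 * x 0 1 ^ 2 + (x 0 0 - x 1 1) ^ 2 + y 0 0 ^ 2 + y 1 1 ^ 2 +
      2 * y 0 1 ^ 2)
    (F : Matrix ((Fin 2 ⊕ Fin 2) ⊕ Fin 1) ((Fin 2 ⊕ Fin 2) ⊕ Fin 1) ℝ)
    (hF : F = Matrix.fromBlocks
      (Matrix.fromBlocks
        (γ • y⁻¹ + δ • (pᵀ * p)) (γ • (y⁻¹ * x) - δ • (qᵀ * p))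
        (γ • (x * y⁻¹) - δ • (pᵀ * q)) (γ • (y + x * y⁻¹ * x) + δ • (qᵀ * q)))
      (Matrix.fromRows (-(δ • pᵀ)) (δ • qᵀ))
      (Matrix.fromCols (-(δ • p)) (δ • q))
      (δ • (1 : Matrix (Fin 1) (Fin 1) ℝ))) :
    F.det = δ * (γ ^ 4 - γ ^ 3 * (δ * I₂ / D) * A - γ ^ 2 * ((δ * I₂) ^ 2 / D) * B -
      γ * ((δ * I₂) ^ 3 / D) * A + (δ * I₂) ^ 4) := by
  have hDpos : 0 < D := by
    have h := hypd.det_pos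
    have h10 : y 1 0 = y 0 1 := hy.apply 0 1
    rw [Matrix.det_fin_two, h10] at h
    rw [hD]; linarith [h]
  have hdet : y.det = D := by
    have h10 : y 1 0 = y 0 1 := hy.apply 0 1
    rw [Matrix.det_fin_two, h10, hD]; ring
  have hu : IsUnit y.det := by rw [hdet]; exact hDpos.ne'.isUnit
  have hx10 : x 1 0 = x 0 1 := hx.apply 0 1
  have hy10 : y 1 0 = y 0 1 := hy.apply 0 1
  letI i1 : Invertible (δ • (1 : Matrix (Fin 1) (Fin 1) ℝ)) :=
    ⟨δ⁻¹ • 1, by simp [smul_smul, hδ.ne'], by simp [smul_smul, hδ.ne']⟩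
  letI i2 : Invertible (γ • y⁻¹) :=
    ⟨γ⁻¹ • y, by simp [smul_smul, hγ.ne', Matrix.mul_nonsing_inv y hu],
      by simp [smul_smul, hγ.ne', Matrix.nonsing_inv_mul y hu]⟩
  have e1 : ⅟ (δ • (1 : Matrix (Fin 1) (Fin 1) ℝ)) = δ⁻¹ • 1 := rfl
  have e2 : ⅟ (γ • y⁻¹) = γ⁻¹ • y := rfl
  have hγ' := hγ.ne'
  have hδ' := hδ.ne'
  set K : Matrix (Fin 2) (Fin 2) ℝ := !![0, δ * I₂; -(δ * I₂), 0] with hK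
  have hred : Matrix.fromBlocks
        (γ • y⁻¹ + δ • (pᵀ * p)) (γ • (y⁻¹ * x) - δ • (qᵀ * p))
        (γ • (x * y⁻¹) - δ • (pᵀ * q)) (γ • (y + x * y⁻¹ * x) + δ • (qᵀ * q)) -
      Matrix.fromRows (-(δ • pᵀ)) (δ • qᵀ) * (δ⁻¹ • (1 : Matrix (Fin 1) (Fin 1) ℝ)) *
        Matrix.fromCols (-(δ • p)) (δ • q) =
      Matrix.fromBlocks (γ • y⁻¹) (γ • (y⁻¹ * x) - K) (γ • (x * y⁻¹) + K)
        (γ • (y + x * y⁻¹ * x)) := by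
    have h1 : Matrix.fromRows (-(δ • pᵀ)) (δ • qᵀ) * (δ⁻¹ • (1 : Matrix (Fin 1) (Fin 1) ℝ)) *
        Matrix.fromCols (-(δ • p)) (δ • q) =
        Matrix.fromBlocks (δ • (pᵀ * p)) (-(δ • (pᵀ * q))) (-(δ • (qᵀ * p))) (δ • (qᵀ * q)) := by
      rw [Matrix.mul_smul, Matrix.mul_one, Matrix.smul_mul, Matrix.fromRows_mul_fromCols]
      simp [Matrix.fromBlocks_smul, smul_smul, hδ']
    have h2 : K = δ • (qᵀ * p) - δ • (pᵀ * q) := by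
      ext i j
      fin_cases i <;> fin_cases j <;> simp [hK, Matrix.mul_apply, hI] <;> ring
    rw [h1, h2, sub_eq_add_neg, Matrix.fromBlocks_neg, Matrix.fromBlocks_add]
    congr 1 <;> abel
  have hred2 : γ • (y + x * y⁻¹ * x) -
      (γ • (x * y⁻¹) + K) * (γ⁻¹ • y) * (γ • (y⁻¹ * x) - K) =
      γ • y - K * x + x * K + γ⁻¹ • (K * y * K) := by
    have c1 : y⁻¹ * y = 1 := Matrix.nonsing_inv_mul y hu
    have c2 : y * y⁻¹ = 1 := Matrix.mul_nonsing_inv y hu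
    have h1 : (γ • (x * y⁻¹) + K) * (γ⁻¹ • y) = x + γ⁻¹ • (K * y) := by
      rw [Matrix.add_mul, Matrix.smul_mul, Matrix.mul_smul, Matrix.mul_smul, Matrix.mul_assoc, c1,
        smul_smul, mul_inv_cancel₀ hγ', one_smul, Matrix.mul_one]
    have h2 : K * y * (y⁻¹ * x) = K * x := by
      rw [Matrix.mul_assoc, ← Matrix.mul_assoc y, c2, Matrix.one_mul]
    rw [h1, Matrix.add_mul, Matrix.mul_sub, Matrix.mul_sub, Matrix.smul_mul, Matrix.smul_mul,
      Matrix.mul_smul, Matrix.mul_smul, h2, smul_smul, inv_mul_cancel₀ hγ', one_smul, smul_add,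
      ← Matrix.mul_assoc]
    abel
  rw [hF, Matrix.det_fromBlocks₂₂, e1, hred, Matrix.det_fromBlocks₁₁, e2, hred2]
  have d1 : (γ • y⁻¹).det = γ ^ 2 / D := by
    rw [Matrix.det_smul, Matrix.det_nonsing_inv, hdet, Ring.inverse_eq_inv']
    simp [div_eq_mul_inv]
  have d2 : (δ • (1 : Matrix (Fin 1) (Fin 1) ℝ)).det = δ := by simp
  have d3 : (γ • y - K * x + x * K + γ⁻¹ • (K * y * K)).det =
      γ ^ 2 * D - γ * (δ * I₂) * A - (δ * I₂) ^ 2 * B - (δ * I₂) ^ 3 / γ * A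
        + (δ * I₂) ^ 4 / γ ^ 2 * D := by
    rw [Matrix.det_fin_two]
    simp only [hK, Matrix.add_apply, Matrix.sub_apply, Matrix.smul_apply, Matrix.mul_apply,
      Fin.sum_univ_two, smul_eq_mul, hx10, hy10, hD, hA, hB, Matrix.of_apply, Matrix.cons_val_zero,
      Matrix.cons_val_one, Matrix.cons_val', Matrix.cons_val_fin_one]
    field_simp
    ring
  rw [d1, d2, d3]
  have := hDpos.ne'
  field_simp
end

section
/- Let x, y be real symmetric 2×2 matrices with y positive definite, let p = (p₁, p₂), q = (q₁, q₂) be real 1×2 row vectors, and let γ, δ > 0. Set D = y₁₁y₂₂ − y₁₂² and I₂ = p₂q₁ − p₁q₂. Let F be the symmetric 5×5 matrix given in blocks (row/column order q₁, q₂, p₁, p₂, κ) by F = [[γ·y⁻¹ + δ·pᵗp, γ·y⁻¹x − δ·qᵗp, −δ·pᵗ], [γ·x y⁻¹ − δ·pᵗq, γ·(y + x y⁻¹ x) + δ·qᵗq, δ·qᵗ], [−δ·p, δ·q, δ]]. Assume det F ≠ 0 and set N = γδ/(det F · D). Then the entries of F⁻¹ satisfy: (F⁻¹)₃₃ = N·[γ²·y₂₂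 + 2γδI₂·x₁₂ − (δI₂)²·y₁₁], (F⁻¹)₃₄ = N·[−γ²·y₁₂ − γδI₂·(x₁₁ − x₂₂) − (δI₂)²·y₁₂], and (F⁻¹)₄₄ = N·[γ²·y₁₁ − 2γδI₂·x₁₂ − (δI₂)²·y₂₂]. -/
open Matrix

theorem aux_inv22 {m n : Type*} [Fintype m] [Fintype n] [DecidableEq m] [DecidableEq n]
    (A : Matrix m m ℝ) (B : Matrix m n ℝ) (C : Matrix n m ℝ) (D : Matrix n n ℝ)
    (hD : D.det ≠ 0) (h : (fromBlocks A B C D).det ≠ 0) :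
    (fromBlocks A B C D).det = D.det * (A - B * D⁻¹ * C).det ∧
    ∀ i j, (fromBlocks A B C D)⁻¹ (Sum.inl i) (Sum.inl j) = (A - B * D⁻¹ * C)⁻¹ i j := by
  let _ := invertibleOfIsUnitDet D (isUnit_iff_ne_zero.2 hD)
  let _ := invertibleOfIsUnitDet _ (isUnit_iff_ne_zero.2 h)
  have e := det_fromBlocks₂₂ A B C D
  have h2 : (A - B * ⅟D * C).det ≠ 0 := by
    intro h0; rw [e, h0, mul_zero] at h; exact h rfl
  let _ := invertibleOfIsUnitDet _ (isUnit_iff_ne_zero.2 h2)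
  have e2 := invOf_fromBlocks₂₂_eq A B C D
  rw [← invOf_eq_nonsing_inv D]
  refine ⟨e, fun i j => ?_⟩
  rw [← invOf_eq_nonsing_inv, e2, fromBlocks_apply₁₁, invOf_eq_nonsing_inv]

theorem aux_inv11 {m n : Type*} [Fintype m] [Fintype n] [DecidableEq m] [DecidableEq n]
    (A : Matrix m m ℝ) (B : Matrix m n ℝ) (C : Matrix n m ℝ) (D : Matrix n n ℝ)
    (hA : A.det ≠ 0) (h : (fromBlocks A B C D).det ≠ 0) :
    (fromBlocks A B C D).det = A.det * (D - C * A⁻¹ * B).det ∧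
    ∀ i j, (fromBlocks A B C D)⁻¹ (Sum.inr i) (Sum.inr j) = (D - C * A⁻¹ * B)⁻¹ i j := by
  let _ := invertibleOfIsUnitDet A (isUnit_iff_ne_zero.2 hA)
  let _ := invertibleOfIsUnitDet _ (isUnit_iff_ne_zero.2 h)
  have e := det_fromBlocks₁₁ A B C D
  have h2 : (D - C * ⅟A * B).det ≠ 0 := by
    intro h0; rw [e, h0, mul_zero] at h; exact h rfl
  let _ := invertibleOfIsUnitDet _ (isUnit_iff_ne_zero.2 h2)
  have e2 := invOf_fromBlocks₁₁_eq A B C D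
  rw [← invOf_eq_nonsing_inv A]
  refine ⟨e, fun i j => ?_⟩
  rw [← invOf_eq_nonsing_inv, e2, fromBlocks_apply₂₂, invOf_eq_nonsing_inv]

/-- Entries `(F⁻¹)₃₃`, `(F⁻¹)₃₄`, `(F⁻¹)₄₄` of the inverse of the
`(q,p,κ)`-block of the metric matrix of the `G^J_2(ℝ)`-invariant metric on the
extended Siegel–Jacobi upper half space `𝒳̃₂ᴶ` (row/column order
`q₁, q₂, p₁, p₂, κ`). -/
theorem inverse_entries_33_34_44
    (x y : Matrix (Fin 2) (Fin 2) ℝ)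
    (hx : x.IsSymm) (hy : y.IsSymm) (hypd : y.PosDef)
    (p q : Matrix (Fin 1) (Fin 2) ℝ) (γ δ : ℝ) (hγ : 0 < γ) (hδ : 0 < δ)
    (D I₂ : ℝ)
    (hD : D = y 0 0 * y 1 1 - y 0 1 ^ 2)
    (hI : I₂ = p 0 1 * q 0 0 - p 0 0 * q 0 1)
    (F : Matrix ((Fin 2 ⊕ Fin 2) ⊕ Fin 1) ((Fin 2 ⊕ Fin 2) ⊕ Fin 1) ℝ)
    (hF : F = Matrix.fromBlocks
      (Matrix.fromBlocks
        (γ • y⁻¹ + δ • (pᵀ * p)) (γ • (y⁻¹ * x) - δ • (qᵀ * p))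
        (γ • (x * y⁻¹) - δ • (pᵀ * q)) (γ • (y + x * y⁻¹ * x) + δ • (qᵀ * q)))
      (Matrix.fromRows (-(δ • pᵀ)) (δ • qᵀ))
      (Matrix.fromCols (-(δ • p)) (δ • q))
      (δ • (1 : Matrix (Fin 1) (Fin 1) ℝ)))
    (hdet : F.det ≠ 0)
    (N : ℝ) (hN : N = γ * δ / (F.det * D)) :
    F⁻¹ (Sum.inl (Sum.inr 0)) (Sum.inl (Sum.inr 0)) =
      N * (γ ^ 2 * y 1 1 + 2 * γ * δ * I₂ * x 0 1 - (δ * I₂) ^ 2 * y 0 0) ∧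
    F⁻¹ (Sum.inl (Sum.inr 0)) (Sum.inl (Sum.inr 1)) =
      N * (-(γ ^ 2 * y 0 1) - γ * δ * I₂ * (x 0 0 - x 1 1) - (δ * I₂) ^ 2 * y 0 1) ∧
    F⁻¹ (Sum.inl (Sum.inr 1)) (Sum.inl (Sum.inr 1)) =
      N * (γ ^ 2 * y 0 0 - 2 * γ * δ * I₂ * x 0 1 - (δ * I₂) ^ 2 * y 1 1) := by
  have hDpos : 0 < y.det := hypd.det_pos
  have hy10 : y 1 0 = y 0 1 := by simpa using congrFun (congrFun hy 0) 1
  have hx10 : x 1 0 = x 0 1 := by simpa using congrFun (congrFun hx 0) 1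
  have hyD : y.det = D := by rw [det_fin_two, hD, hy10]; ring
  have hD0 : D ≠ 0 := by rw [← hyD]; exact hDpos.ne'
  have hyu : IsUnit y.det := isUnit_iff_ne_zero.2 hDpos.ne'
  have hγ0 := hγ.ne'
  have hδ0 := hδ.ne'
  set J : Matrix (Fin 2) (Fin 2) ℝ := !![0, 1; -1, 0] with hJ
  have hd1 : (δ • (1 : Matrix (Fin 1) (Fin 1) ℝ)).det = δ := by simp
  have hdi : (δ • (1 : Matrix (Fin 1) (Fin 1) ℝ))⁻¹ = δ⁻¹ • 1 := by
    apply inv_eq_right_inv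
    rw [smul_mul_smul_comm, mul_inv_cancel₀ hδ0]; simp
  have hanti : pᵀ * q - qᵀ * p = (-I₂) • J := by
    ext i j
    fin_cases i <;> fin_cases j <;> simp [hJ, hI, Matrix.mul_apply] <;> ring
  have hdF := hdet
  rw [hF] at hdF
  obtain ⟨e1, e2⟩ := aux_inv22 _ _ _ _ (by rw [hd1]; exact hδ0) hdF
  rw [← hF] at e1 e2
  have hS : (Matrix.fromBlocks
        (γ • y⁻¹ + δ • (pᵀ * p)) (γ • (y⁻¹ * x) - δ • (qᵀ * p))
        (γ • (x * y⁻¹) - δ • (pᵀ * q)) (γ • (y + x * y⁻¹ * x) + δ • (qᵀ * q))) -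
      (Matrix.fromRows (-(δ • pᵀ)) (δ • qᵀ)) * (δ • (1 : Matrix (Fin 1) (Fin 1) ℝ))⁻¹ *
      (Matrix.fromCols (-(δ • p)) (δ • q)) =
      fromBlocks (γ • y⁻¹) (γ • (y⁻¹ * x) - (δ * I₂) • J)
        (γ • (x * y⁻¹) + (δ * I₂) • J) (γ • (y + x * y⁻¹ * x)) := by
    have h1 : (δ * I₂) • J = δ • (qᵀ * p) - δ • (pᵀ * q) := by
      rw [← smul_sub, ← neg_sub, hanti, smul_neg, neg_smul, smul_neg, neg_neg, smul_smul]
    rw [hdi, h1, Matrix.mul_smul, Matrix.mul_one, Matrix.smul_mul, fromRows_mul_fromCols]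
    ext (i | i) (j | j) <;> simp <;> field_simp <;> ring
  rw [hS] at e1 e2
  have hyi : (γ • y⁻¹).det ≠ 0 := by
    rw [det_smul, det_nonsing_inv, Ring.inverse_eq_inv', hyD]; simp [hγ0, hD0]
  have hS0 := right_ne_zero_of_mul (e1 ▸ hdet)
  obtain ⟨e3, e4⟩ := aux_inv11 _ _ _ _ hyi hS0
  have hgi : (γ • y⁻¹)⁻¹ = γ⁻¹ • y := by
    apply inv_eq_right_inv
    rw [smul_mul_smul_comm, mul_inv_cancel₀ hγ0, nonsing_inv_mul _ hyu, one_smul]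
  have hM : γ • (y + x * y⁻¹ * x) - (γ • (x * y⁻¹) + (δ * I₂) • J) * (γ • y⁻¹)⁻¹ *
      (γ • (y⁻¹ * x) - (δ * I₂) • J) =
      γ • y + (δ * I₂) • (x * J - J * x) + ((δ * I₂)^2 * γ⁻¹) • (J * y * J) := by
    have a1 : (γ • (x * y⁻¹) + (δ * I₂) • J) * (γ⁻¹ • y) = x + (δ * I₂ * γ⁻¹) • (J * y) := by
      rw [add_mul, smul_mul_smul_comm, smul_mul_smul_comm, mul_inv_cancel₀ hγ0, Matrix.mul_assoc,
        nonsing_inv_mul _ hyu, Matrix.mul_one, one_smul]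
    have a2 : J * y * (y⁻¹ * x) = J * x := by
      rw [Matrix.mul_assoc, ← Matrix.mul_assoc y, mul_nonsing_inv _ hyu, Matrix.one_mul]
    rw [hgi, a1, add_mul, mul_sub, mul_sub, smul_mul_smul_comm, smul_mul_smul_comm, a2,
      Matrix.mul_smul, Matrix.mul_smul, Matrix.mul_assoc x]
    have a3 : δ * I₂ * γ⁻¹ * γ = δ * I₂ := by field_simp
    rw [a3]
    module
  rw [hM] at e3 e4
  set M := γ • y + (δ * I₂) • (x * J - J * x) + ((δ * I₂)^2 * γ⁻¹) • (J * y * J) with hMdef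
  have hMd : F.det = δ * (γ ^ 2 * D⁻¹ * M.det) := by
    rw [e1, e3, hd1, det_smul, det_nonsing_inv, Ring.inverse_eq_inv', hyD]; simp
  have hM0 : M.det ≠ 0 := by
    intro h; rw [h] at hMd; simp at hMd; exact hdet hMd
  have hNN : N = γ⁻¹ * M.det⁻¹ := by
    rw [hN, hMd]; field_simp
  have j00 : J 0 0 = 0 := by simp [hJ]
  have j01 : J 0 1 = 1 := by simp [hJ]
  have j10 : J 1 0 = -1 := by simp [hJ]
  have j11 : J 1 1 = 0 := by simp [hJ]
  have m00 : M 0 0 = γ * y 0 0 - 2 * δ * I₂ * x 0 1 - (δ * I₂)^2 * γ⁻¹ * y 1 1 := by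
    simp only [hMdef, Matrix.add_apply, Matrix.sub_apply, Matrix.smul_apply, smul_eq_mul,
      Matrix.mul_apply, Fin.sum_univ_two, hx10, hy10, j00, j01, j10, j11]; ring
  have m01 : M 0 1 = γ * y 0 1 + δ * I₂ * (x 0 0 - x 1 1) + (δ * I₂)^2 * γ⁻¹ * y 0 1 := by
    simp only [hMdef, Matrix.add_apply, Matrix.sub_apply, Matrix.smul_apply, smul_eq_mul,
      Matrix.mul_apply, Fin.sum_univ_two, hx10, hy10, j00, j01, j10, j11]; ring
  have m11 : M 1 1 = γ * y 1 1 + 2 * δ * I₂ * x 0 1 - (δ * I₂)^2 * γ⁻¹ * y 0 0 := by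
    simp only [hMdef, Matrix.add_apply, Matrix.sub_apply, Matrix.smul_apply, smul_eq_mul,
      Matrix.mul_apply, Fin.sum_univ_two, hx10, hy10, j00, j01, j10, j11]; ring
  have hMi : M⁻¹ = M.det⁻¹ • !![M 1 1, -M 0 1; -M 1 0, M 0 0] := by
    rw [inv_def, Ring.inverse_eq_inv', adjugate_fin_two]
  clear_value M
  rw [e2, e2, e2, e4, e4, e4, hMi, hNN]
  refine ⟨?_, ?_, ?_⟩
  · simp [m11]; field_simp
  · simp [m01]; field_simp; ring
  · simp [m00]; field_simp
end

section
/- Let x, y be real symmetric 2×2 matrices with y positive definite, let p = (p₁, p₂), q = (q₁, q₂) be real 1×2 row vectors, and let γ, δ > 0. Set D = y₁₁y₂₂ − y₁₂² and I₂ = p₂q₁ − p₁q₂. Let F be the symmetric 5×5 matrix given in blocks (row/column order q₁, q₂, p₁, p₂, κ) by F = [[γ·y⁻¹ + δ·pᵗp, γ·y⁻¹x − δ·qᵗp, −δ·pᵗ], [γ·x y⁻¹ − δ·pᵗq, γ·(y + x y⁻¹ x) + δ·qᵗq, δ·qᵗ], [−δ·p, δ·q, δ]]. Assume det F ≠ 0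 and set N = γδ/(det F · D). Then (F⁻¹)₁₃ = N·[γ²·(x₁₂y₁₂ − x₁₁y₂₂) − γδI₂·(x₁₂(x₁₁ + x₂₂) + y₁₂(y₁₁ + y₂₂)) + (δI₂)²·(x₂₂y₁₁ − x₁₂y₁₂)] and (F⁻¹)₂₄ = N·[−γ²·(x₂₂y₁₁ − x₁₂y₁₂) + γδI₂·(x₁₂(x₁₁ + x₂₂) + y₁₂(y₁₁ + y₂₂)) − (δI₂)²·(x₁₂y₁₂ − x₁₁y₂₂)]. -/
open Matrix

/-- The column solving `F c = t e` determines the column of the inverse. -/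
lemma inv_entry_aux {n : Type*} [Fintype n] [DecidableEq n] (F : Matrix n n ℝ)
    (hdet : F.det ≠ 0) (c : n → ℝ) (t : ℝ) (ht : t ≠ 0) (i j : n)
    (h : F *ᵥ c = t • Pi.single j 1) : F⁻¹ i j = c i / t := by
  have h1 : F⁻¹ *ᵥ (F *ᵥ c) = c := by
    rw [Matrix.mulVec_mulVec, Matrix.nonsing_inv_mul _ (isUnit_iff_ne_zero.mpr hdet),
      Matrix.one_mulVec]
  rw [h, Matrix.mulVec_smul, Matrix.mulVec_single_one] at h1
  have h2 := congrFun h1 i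
  simp at h2
  field_simp
  linarith

set_option maxHeartbeats 4000000 in
/-- Entries `(F⁻¹)₁₃` and `(F⁻¹)₂₄` of the inverse of the
`(q,p,κ)`-block of the metric matrix of the `G^J_2(ℝ)`-invariant metric on the
extended Siegel–Jacobi upper half space `𝒳̃₂ᴶ` (row/column order
`q₁, q₂, p₁, p₂, κ`). -/
theorem inverse_entries_13_24
    (x y : Matrix (Fin 2) (Fin 2) ℝ)
    (hx : x.IsSymm) (hy : y.IsSymm) (hypd : y.PosDef)
    (p q : Matrix (Fin 1) (Fin 2) ℝ) (γ δ : ℝ) (hγ : 0 < γ) (hδ : 0 < δ)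
    (D I₂ : ℝ)
    (hD : D = y 0 0 * y 1 1 - y 0 1 ^ 2)
    (hI : I₂ = p 0 1 * q 0 0 - p 0 0 * q 0 1)
    (F : Matrix ((Fin 2 ⊕ Fin 2) ⊕ Fin 1) ((Fin 2 ⊕ Fin 2) ⊕ Fin 1) ℝ)
    (hF : F = Matrix.fromBlocks
      (Matrix.fromBlocks
        (γ • y⁻¹ + δ • (pᵀ * p)) (γ • (y⁻¹ * x) - δ • (qᵀ * p))
        (γ • (x * y⁻¹) - δ • (pᵀ * q)) (γ • (y + x * y⁻¹ * x) + δ • (qᵀ * q)))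
      (Matrix.fromRows (-(δ • pᵀ)) (δ • qᵀ))
      (Matrix.fromCols (-(δ • p)) (δ • q))
      (δ • (1 : Matrix (Fin 1) (Fin 1) ℝ)))
    (hdet : F.det ≠ 0)
    (N : ℝ) (hN : N = γ * δ / (F.det * D)) :
    F⁻¹ (Sum.inl (Sum.inl 0)) (Sum.inl (Sum.inr 0)) =
      N * (γ ^ 2 * (x 0 1 * y 0 1 - x 0 0 * y 1 1) -
        γ * δ * I₂ * (x 0 1 * (x 0 0 + x 1 1) + y 0 1 * (y 0 0 + y 1 1)) +
        (δ * I₂) ^ 2 * (x 1 1 * y 0 0 - x 0 1 * y 0 1)) ∧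
    F⁻¹ (Sum.inl (Sum.inl 1)) (Sum.inl (Sum.inr 1)) =
      N * (-(γ ^ 2 * (x 1 1 * y 0 0 - x 0 1 * y 0 1)) +
        γ * δ * I₂ * (x 0 1 * (x 0 0 + x 1 1) + y 0 1 * (y 0 0 + y 1 1)) -
        (δ * I₂) ^ 2 * (x 0 1 * y 0 1 - x 0 0 * y 1 1)) := by
  have hDpos : 0 < D := by
    have h := hypd.det_pos
    rw [Matrix.det_fin_two] at h
    have h10 : y 1 0 = y 0 1 := hy.apply 0 1
    rw [h10] at h
    rw [hD]; linarith
  have hx10 : x 1 0 = x 0 1 := hx.apply 0 1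
  have hy10 : y 1 0 = y 0 1 := hy.apply 0 1
  have hD0 : D ≠ 0 := hDpos.ne'
  have hg0 : γ ≠ 0 := hγ.ne'
  have hd0 : δ ≠ 0 := hδ.ne'
  clear hypd hx hy
  have hyinv : y⁻¹ = !![y 1 1 / D, -(y 0 1) / D; -(y 0 1) / D, y 0 0 / D] := by
    apply Matrix.inv_eq_right_inv
    ext i j
    fin_cases i <;> fin_cases j <;>
      simp [Matrix.mul_apply, Fin.sum_univ_two, hy10] <;> field_simp <;> rw [hD] <;> ring
  rw [hyinv] at hF
  clear hyinv
  generalize hx00 : x 0 0 = a at *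
  generalize hx01 : x 0 1 = b at *
  generalize hx11 : x 1 1 = d at *
  generalize hy00 : y 0 0 = e at *
  generalize hy01 : y 0 1 = f at *
  generalize hy11 : y 1 1 = g at *
  generalize hp0 : p 0 0 = p1 at *
  generalize hp1 : p 0 1 = p2 at *
  generalize hq0 : q 0 0 = q1 at *
  generalize hq1 : q 0 1 = q2 at *
  have hxe : x = !![a, b; b, d] := by
    rw [Matrix.eta_fin_two x, hx00, hx01, hx10, hx11]
  have hye : y = !![e, f; f, g] := by
    rw [Matrix.eta_fin_two y, hy00, hy01, hy10, hy11]
  have hpe : p = !![p1, p2] := by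
    ext i j; fin_cases i; fin_cases j <;> simp [hp0, hp1]
  have hqe : q = !![q1, q2] := by
    ext i j; fin_cases i; fin_cases j <;> simp [hq0, hq1]
  subst hxe hye hpe hqe
  clear hx00 hx01 hx10 hx11 hy00 hy01 hy10 hy11 hp0 hp1 hq0 hq1
  obtain ⟨s, hs⟩ : ∃ s, s = δ * I₂ := ⟨_, rfl⟩
  -- the Schur complement
  obtain ⟨S1, hS1⟩ : ∃ S1, S1 = γ * e - 2 * s * b - s ^ 2 / γ * g := ⟨_, rfl⟩
  obtain ⟨S2, hS2⟩ : ∃ S2, S2 = γ * f + s * (a - d) + s ^ 2 / γ * f := ⟨_, rfl⟩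
  obtain ⟨S3, hS3⟩ : ∃ S3, S3 = γ * g + 2 * s * b - s ^ 2 / γ * e := ⟨_, rfl⟩
  obtain ⟨t, htt⟩ : ∃ t, t = S1 * S3 - S2 ^ 2 := ⟨_, rfl⟩
  have hdetF : F.det = δ * γ ^ 2 * t / D := by
    have hdl : (δ • (1 : Matrix (Fin 1) (Fin 1) ℝ)) * (δ⁻¹ • 1) = 1 := by
      simp [smul_smul, hd0]
    letI i1 : Invertible (δ • (1 : Matrix (Fin 1) (Fin 1) ℝ)) := ⟨_, mul_eq_one_comm.mp hdl, hdl⟩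
    have hi1 : ⅟(δ • (1 : Matrix (Fin 1) (Fin 1) ℝ)) = δ⁻¹ • 1 := rfl
    have hM : F.det = δ * (Matrix.fromBlocks (γ • !![g / D, -f / D; -f / D, e / D])
        (γ • (!![g / D, -f / D; -f / D, e / D] * !![a, b; b, d]) - s • !![0, 1; -1, 0])
        (γ • (!![a, b; b, d] * !![g / D, -f / D; -f / D, e / D]) + s • !![0, 1; -1, 0])
        (γ • (!![e, f; f, g] + !![a, b; b, d] * !![g / D, -f / D; -f / D, e / D] * !![a, b; b, d]))).det := by
      rw [hF, Matrix.det_fromBlocks₂₂, hi1]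
      congr 1
      · simp
      · congr 1
        ext i j
        rw [hs, hI]
        rcases i with i | i <;> rcases j with j | j <;> fin_cases i <;> fin_cases j <;>
          simp [Matrix.mul_apply] <;> field_simp <;> ring
    have hyl : (γ • !![g / D, -f / D; -f / D, e / D]) * (γ⁻¹ • !![e, f; f, g]) = 1 := by
      ext i j
      fin_cases i <;> fin_cases j <;>
        simp [Matrix.mul_apply, Fin.sum_univ_two] <;> field_simp <;> (try rw [hD]) <;> ring
    letI i2 : Invertible (γ • !![g / D, -f / D; -f / D, e / D]) := ⟨_, mul_eq_one_comm.mp hyl, hyl⟩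
    have hi2 : ⅟(γ • !![g / D, -f / D; -f / D, e / D]) = γ⁻¹ • !![e, f; f, g] := rfl
    have hS : γ • (!![e, f; f, g] + !![a, b; b, d] * !![g / D, -f / D; -f / D, e / D] * !![a, b; b, d])
        - (γ • (!![a, b; b, d] * !![g / D, -f / D; -f / D, e / D]) + s • !![0, 1; -1, 0])
        * (γ⁻¹ • !![e, f; f, g]) *
        (γ • (!![g / D, -f / D; -f / D, e / D] * !![a, b; b, d]) - s • !![0, 1; -1, 0])
        = !![S1, S2; S2, S3] := by
      ext i j
      fin_cases i <;> fin_cases j <;>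
        simp [Matrix.mul_apply, Fin.sum_univ_two] <;> (try rw [hS1]) <;> (try rw [hS2]) <;>
        (try rw [hS3]) <;> field_simp <;> rw [hD] <;> ring
    rw [hM, Matrix.det_fromBlocks₁₁, hi2, hS, Matrix.det_fin_two, Matrix.det_fin_two, htt]
    simp
    field_simp
    rw [hD]
    ring
  have ht : t ≠ 0 := by
    rintro rfl
    apply hdet
    rw [hdetF]; simp
  have key : ∀ u v w z : ℝ, F *ᵥ (Sum.elim (Sum.elim ![u, v] ![w, z])
      ![p1 * u + p2 * v - q1 * w - q2 * z]) =
      Sum.elim (Sum.elim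
        ![γ * (g * (u + a * w + b * z) - f * (v + b * w + d * z)) / D - s * z,
          γ * (e * (v + b * w + d * z) - f * (u + a * w + b * z)) / D + s * w]
        ![γ * (a * (g * (u + a * w + b * z) - f * (v + b * w + d * z)) / D
            + b * (e * (v + b * w + d * z) - f * (u + a * w + b * z)) / D + e * w + f * z) + s * v,
          γ * (b * (g * (u + a * w + b * z) - f * (v + b * w + d * z)) / D
            + d * (e * (v + b * w + d * z) - f * (u + a * w + b * z)) / D + f * w + g * z) - s * u])
        ![0] := by
    intro u v w z
    rw [hF, hs, hI]
    funext i
    rcases i with (i | i) | i <;> fin_cases i <;>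
      simp [Matrix.mulVec, dotProduct, Fintype.sum_sum_type, Fin.sum_univ_two,
        Matrix.mul_apply, Matrix.vecMul] <;> ring
  constructor
  · rw [inv_entry_aux F hdet (Sum.elim (Sum.elim
        ![-((a + s / γ * f) * S3 - (b - s / γ * e) * S2), -((b + s / γ * g) * S3 - (d - s / γ * f) * S2)] ![S3, -S2])
        ![p1 * -((a + s / γ * f) * S3 - (b - s / γ * e) * S2)
          + p2 * -((b + s / γ * g) * S3 - (d - s / γ * f) * S2) - q1 * S3 - q2 * -S2]) t ht _ _ ?_]
    · rw [hN, hdetF, ← hs]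
      simp only [Sum.elim_inl, Matrix.cons_val_zero]
      field_simp
      rw [hS3, hS2, ← hs]
      field_simp
      ring
    · rw [key]
      funext i
      rcases i with (i | i) | i <;> fin_cases i <;>
        simp [Pi.single_apply] <;> field_simp <;> rw [hD] <;> (try rw [htt]) <;>
        (try rw [hS1]) <;> (try rw [hS2]) <;> (try rw [hS3]) <;> field_simp <;> ring
  · rw [inv_entry_aux F hdet (Sum.elim (Sum.elim
        ![-((a + s / γ * f) * -S2 + (b - s / γ * e) * S1), -((b + s / γ * g) * -S2 + (d - s / γ * f) * S1)] ![-S2, S1])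
        ![p1 * -((a + s / γ * f) * -S2 + (b - s / γ * e) * S1)
          + p2 * -((b + s / γ * g) * -S2 + (d - s / γ * f) * S1) - q1 * -S2 - q2 * S1]) t ht _ _ ?_]
    · rw [hN, hdetF, ← hs]
      simp only [Sum.elim_inl, Matrix.cons_val_one, Matrix.cons_val_zero]
      field_simp
      rw [hS1, hS2, ← hs]
      field_simp
      ring
    · rw [key]
      funext i
      rcases i with (i | i) | i <;> fin_cases i <;>
        simp [Pi.single_apply] <;> field_simp <;> rw [hD] <;> (try rw [htt]) <;>
        (try rw [hS1]) <;> (try rw [hS2]) <;> (try rw [hS3]) <;> field_simp <;> ring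
end

section
/- Let x, y be real symmetric 2×2 matrices with y positive definite, let p = (p₁, p₂), q = (q₁, q₂) be real 1×2 row vectors, and let γ, δ > 0. Set D = y₁₁y₂₂ − y₁₂² and I₂ = p₂q₁ − p₁q₂. Let F be the symmetric 5×5 matrix given in blocks (row/column order q₁, q₂, p₁, p₂, κ) by F = [[γ·y⁻¹ + δ·pᵗp, γ·y⁻¹x − δ·qᵗp, −δ·pᵗ], [γ·x y⁻¹ − δ·pᵗq, γ·(y + x y⁻¹ x) + δ·qᵗq, δ·qᵗ], [−δ·p, δ·q, δ]]. Assume det F ≠ 0 and set N = γδ/(det F · D). Then (F⁻¹)₁₄ = N·[γ²·(x₁₁y₁₂ − x₁₂y₁₁) + γδI₂·(x₁₁² + 2x₁₂² − x₁₁x₂₂ + y₁₁² + y₁₂²) + (δI₂)²·(2x₁₁y₁₂ − 2x₁₂y₁₁ − x₂₂y₁₂ + x₁₂y₂₂) − D(δI₂)³/γ] and (F⁻¹)₂₃ = N·[γ²·(x₂₂y₁₂ − x₁₂y₂₂) + γδI₂·(−2x₁₂² + x₁₁x₂₂ − x₂₂² − y₁₂² − y₂₂²) + (δI₂)²·(x₁₂y₁₁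 − x₁₁y₁₂ + 2x₂₂y₁₂ − 2x₁₂y₂₂) + D(δI₂)³/γ]. -/
open Matrix

/-- Two entries of the inverse of the symmetric `4 × 4` Schur complement, times its determinant. -/
theorem schur_adjugate_entries (a b c y₁ y₂ y₃ g e D : ℝ) (hD0 : D ≠ 0) (hg : g ≠ 0)
    (hD : D = y₁ * y₃ - y₂ ^ 2) (A : Matrix (Fin 4) (Fin 4) ℝ)
    (hA : A = !![g * (y₃ / D), g * (-y₂ / D), g * ((y₃ * a - y₂ * b) / D),
          g * ((y₃ * b - y₂ * c) / D) - e;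
        g * (-y₂ / D), g * (y₁ / D), g * ((y₁ * b - y₂ * a) / D) + e,
          g * ((y₁ * c - y₂ * b) / D);
        g * ((y₃ * a - y₂ * b) / D), g * ((y₁ * b - y₂ * a) / D) + e,
          g * (y₁ + (y₃ * a ^ 2 - 2 * y₂ * a * b + y₁ * b ^ 2) / D),
          g * (y₂ + (y₃ * a * b - y₂ * (a * c + b ^ 2) + y₁ * b * c) / D);
        g * ((y₃ * b - y₂ * c) / D) - e, g * ((y₁ * c - y₂ * b) / D),
          g * (y₂ + (y₃ * a * b - y₂ * (a * c + b ^ 2) + y₁ * b * c) / D),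
          g * (y₃ + (y₃ * b ^ 2 - 2 * y₂ * b * c + y₁ * c ^ 2) / D)]) :
    A.adjugate 0 3 = g / D * (g ^ 2 * (a * y₂ - b * y₁) +
        g * e * (a ^ 2 + 2 * b ^ 2 - a * c + y₁ ^ 2 + y₂ ^ 2) +
        e ^ 2 * (2 * a * y₂ - 2 * b * y₁ - c * y₂ + b * y₃) - D * e ^ 3 / g) ∧
    A.adjugate 1 2 = g / D * (g ^ 2 * (c * y₂ - b * y₃) +
        g * e * (-(2 * b ^ 2) + a * c - c ^ 2 - y₂ ^ 2 - y₃ ^ 2) +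
        e ^ 2 * (b * y₁ - a * y₂ + 2 * c * y₂ - 2 * b * y₃) + D * e ^ 3 / g) := by
  subst hA
  constructor
  · rw [Matrix.adjugate_fin_succ_eq_det_submatrix]
    simp [Matrix.det_fin_three, Fin.succAbove, Fin.lt_def]
    field_simp
    subst hD
    ring
  · rw [Matrix.adjugate_fin_succ_eq_det_submatrix]
    simp [Matrix.det_fin_three, Fin.succAbove, Fin.lt_def]
    field_simp
    subst hD
    ring

/-- The upper left block of a block inverse is the inverse of the Schur complement. -/
theorem inv_fromBlocks_inl_inl {m n : Type*} [Fintype m] [Fintype n] [DecidableEq m]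
    [DecidableEq n] (A : Matrix m m ℝ) (B : Matrix m n ℝ) (C : Matrix n m ℝ) (D : Matrix n n ℝ)
    [Invertible D] (h : IsUnit (Matrix.fromBlocks A B C D).det) (i j : m) :
    (Matrix.fromBlocks A B C D)⁻¹ (Sum.inl i) (Sum.inl j) = (A - B * ⅟D * C)⁻¹ i j := by
  let i1 : Invertible (Matrix.fromBlocks A B C D) := Matrix.invertibleOfIsUnitDet _ h
  let i2 : Invertible (A - B * ⅟D * C) := Matrix.invertibleOfFromBlocks₂₂Invertible A B C D
  rw [← Matrix.invOf_eq_nonsing_inv, Matrix.invOf_fromBlocks₂₂_eq, Matrix.fromBlocks_apply₁₁,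
    Matrix.invOf_eq_nonsing_inv]

/-- Entries `(F⁻¹)₁₄` and `(F⁻¹)₂₃` of the inverse of the
`(q,p,κ)`-block of the metric matrix of the `G^J_2(ℝ)`-invariant metric on the
extended Siegel–Jacobi upper half space `𝒳̃₂ᴶ` (row/column order
`q₁, q₂, p₁, p₂, κ`). -/
theorem inverse_entries_14_23
    (x y : Matrix (Fin 2) (Fin 2) ℝ)
    (hx : x.IsSymm) (hy : y.IsSymm) (hypd : y.PosDef)
    (p q : Matrix (Fin 1) (Fin 2) ℝ) (γ δ : ℝ) (hγ : 0 < γ) (hδ : 0 < δ)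
    (D I₂ : ℝ)
    (hD : D = y 0 0 * y 1 1 - y 0 1 ^ 2)
    (hI : I₂ = p 0 1 * q 0 0 - p 0 0 * q 0 1)
    (F : Matrix ((Fin 2 ⊕ Fin 2) ⊕ Fin 1) ((Fin 2 ⊕ Fin 2) ⊕ Fin 1) ℝ)
    (hF : F = Matrix.fromBlocks
      (Matrix.fromBlocks
        (γ • y⁻¹ + δ • (pᵀ * p)) (γ • (y⁻¹ * x) - δ • (qᵀ * p))
        (γ • (x * y⁻¹) - δ • (pᵀ * q)) (γ • (y + x * y⁻¹ * x) + δ • (qᵀ * q)))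
      (Matrix.fromRows (-(δ • pᵀ)) (δ • qᵀ))
      (Matrix.fromCols (-(δ • p)) (δ • q))
      (δ • (1 : Matrix (Fin 1) (Fin 1) ℝ)))
    (hdet : F.det ≠ 0)
    (N : ℝ) (hN : N = γ * δ / (F.det * D)) :
    F⁻¹ (Sum.inl (Sum.inl 0)) (Sum.inl (Sum.inr 1)) =
      N * (γ ^ 2 * (x 0 0 * y 0 1 - x 0 1 * y 0 0) +
        γ * δ * I₂ * (x 0 0 ^ 2 + 2 * x 0 1 ^ 2 - x 0 0 * x 1 1 + y 0 0 ^ 2 + y 0 1 ^ 2) +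
        (δ * I₂) ^ 2 *
          (2 * x 0 0 * y 0 1 - 2 * x 0 1 * y 0 0 - x 1 1 * y 0 1 + x 0 1 * y 1 1) -
        D * (δ * I₂) ^ 3 / γ) ∧
    F⁻¹ (Sum.inl (Sum.inl 1)) (Sum.inl (Sum.inr 0)) =
      N * (γ ^ 2 * (x 1 1 * y 0 1 - x 0 1 * y 1 1) +
        γ * δ * I₂ *
          (-(2 * x 0 1 ^ 2) + x 0 0 * x 1 1 - x 1 1 ^ 2 - y 0 1 ^ 2 - y 1 1 ^ 2) +
        (δ * I₂) ^ 2 *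
          (x 0 1 * y 0 0 - x 0 0 * y 0 1 + 2 * x 1 1 * y 0 1 - 2 * x 0 1 * y 1 1) +
        D * (δ * I₂) ^ 3 / γ) := by
  have hD0 : D ≠ 0 := by
    have h := hypd.det_pos
    rw [Matrix.det_fin_two] at h
    have h1 : y 1 0 = y 0 1 := hy.apply 0 1
    rw [h1] at h
    rw [hD]; nlinarith
  have hy1 : y 1 0 = y 0 1 := hy.apply 0 1
  have hx1 : x 1 0 = x 0 1 := hx.apply 0 1
  have hdy : y.det = D := by rw [Matrix.det_fin_two, hy1, hD]; ring
  have hyi : y⁻¹ = !![y 1 1 / D, -y 0 1 / D; -y 0 1 / D, y 0 0 / D] := by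
    rw [Matrix.inv_def, Matrix.adjugate_fin_two, hdy, hy1, Ring.inverse_eq_inv']
    ext i j; fin_cases i <;> fin_cases j <;> simp <;> ring
  obtain ⟨h14, h23⟩ := schur_adjugate_entries (x 0 0) (x 0 1) (x 1 1) (y 0 0) (y 0 1) (y 1 1)
    γ (δ * I₂) D hD0 hγ.ne' hD _ rfl
  set A : Matrix (Fin 4) (Fin 4) ℝ := !![_, _, _, _; _, _, _, _; _, _, _, _; _, _, _, _] with hA
  let dinv : Invertible (δ • (1 : Matrix (Fin 1) (Fin 1) ℝ)) :=
    ⟨δ⁻¹ • 1, by simp [smul_smul, hδ.ne'], by simp [smul_smul, hδ.ne']⟩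
  have hdi : ⅟(δ • (1 : Matrix (Fin 1) (Fin 1) ℝ)) = δ⁻¹ • 1 := rfl
  have hS : Matrix.fromBlocks
        (γ • y⁻¹ + δ • (pᵀ * p)) (γ • (y⁻¹ * x) - δ • (qᵀ * p))
        (γ • (x * y⁻¹) - δ • (pᵀ * q)) (γ • (y + x * y⁻¹ * x) + δ • (qᵀ * q)) -
      (Matrix.fromRows (-(δ • pᵀ)) (δ • qᵀ)) * ⅟(δ • (1 : Matrix (Fin 1) (Fin 1) ℝ)) *
      (Matrix.fromCols (-(δ • p)) (δ • q)) =
      A.submatrix (finSumFinEquiv : Fin 2 ⊕ Fin 2 ≃ Fin 4)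
        (finSumFinEquiv : Fin 2 ⊕ Fin 2 ≃ Fin 4) := by
    have hδ0 := hδ.ne'
    rw [hdi, hyi, hA, hI]
    ext i j
    rcases i with i | i <;> rcases j with j | j <;> fin_cases i <;> fin_cases j <;>
      simp [Matrix.mul_apply, Matrix.vecMul, dotProduct, Fin.sum_univ_two, finSumFinEquiv, hx1, hy1] <;>
      field_simp <;> ring
  have hFdet : F.det = δ * A.det := by
    rw [hF, Matrix.det_fromBlocks₂₂, hS, Matrix.det_submatrix_equiv_self]
    simp
  have hAdet : A.det ≠ 0 := fun h => hdet (by rw [hFdet, h, mul_zero])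
  have hAu : IsUnit A.det := hAdet.isUnit
  have hFinv : ∀ i j : Fin 2 ⊕ Fin 2, F⁻¹ (Sum.inl i) (Sum.inl j) =
      A⁻¹ (finSumFinEquiv i) (finSumFinEquiv j) := by
    intro i j
    have hFu : IsUnit F.det := hdet.isUnit
    rw [hF] at hFu ⊢
    rw [inv_fromBlocks_inl_inl _ _ _ _ hFu, hS, Matrix.inv_submatrix_equiv]
    rfl
  have hinv : ∀ i j, A⁻¹ i j = (A.det)⁻¹ * A.adjugate i j := by
    intro i j
    rw [Matrix.inv_def, Ring.inverse_eq_inv']; rfl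
  have hNe : N = (A.det)⁻¹ * (γ / D) := by
    rw [hN, hFdet]
    have := hδ.ne'
    field_simp
  rw [hFinv, hFinv, hinv, hinv]
  have e14 : A.adjugate (finSumFinEquiv (Sum.inl 0 : Fin 2 ⊕ Fin 2))
    (finSumFinEquiv (Sum.inr 1 : Fin 2 ⊕ Fin 2)) = A.adjugate 0 3 := rfl
  have e23 : A.adjugate (finSumFinEquiv (Sum.inl 1 : Fin 2 ⊕ Fin 2))
    (finSumFinEquiv (Sum.inr 0 : Fin 2 ⊕ Fin 2)) = A.adjugate 1 2 := rfl
  rw [e14, e23, h14, h23, hNe]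
  constructor <;> ring
end
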